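/- Let 1 ≤ k and 0 ≤ m be integers and u_1, …, u_{m+k} ∈ ℝ^m with u_1, …, u_m linearly independent (if m > 0). Let w_1, …, w_{m+k} ∈ D^k([a,b]) satisfy V_n(ξ) := W(w_1,…,w_{m+n}; u_1,…,u_{m+n})(ξ,…,ξ) ≠ 0 for all ξ ∈ [a,b] and n = 1, …, k. Assume that f ∈ D^k([a,b]) vanishes k+1 times in [a,b]. Then for each 0 ≤ n ≤ k, the function 𝒲_n(f)(ξ) := W(w_1,…,w_{m+n},f; u_1,…,u_{m+n},0)(ξ,…,ξ) vanishes k+1−n times in [a,b]. -/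

import Mathlib

/-- The derivative order attached to column `j`: the number of earlier indices carrying
the same point value as `x j`. -/
noncomputable def multBefore {k : ℕ} (x : Fin k → ℝ) (j : Fin k) : ℕ :=
  Nat.card {i : Fin k // i < j ∧ x i = x j}

/-- Generalized Wronskian determinant of the system `w` at the points `x`
(repetitions of a point produce successive derivative columns). -/
noncomputable def genW {k : ℕ} (w : Fin k → ℝ → ℝ) (x : Fin k → ℝ) : ℝ :=
  Matrix.det (Matrix.of fun i j : Fin k => iteratedDeriv (multBefore x j) (w i) (x j))

/-- Generalized Wronskian determinant with a vector part: the first `m` columns are the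
coordinates of the vectors `u i`, the remaining `k` columns are derivative columns at `x`. -/
noncomputable def genWu (m k : ℕ) (w : Fin (m + k) → ℝ → ℝ) (u : Fin (m + k) → Fin m → ℝ)
    (x : Fin k → ℝ) : ℝ :=
  Matrix.det (Matrix.of fun i j : Fin (m + k) =>
    Fin.addCases (fun jm : Fin m => u i jm)
      (fun jk : Fin k => iteratedDeriv (multBefore x jk) (w i) (x jk)) j)

/-- `f ∈ D^k([a,b])`: `f` is `k-1` times continuously differentiable on `[a,b]` and
`k` times differentiable on `]a,b[`. -/
def MemDk (k : ℕ) (a b : ℝ) (f : ℝ → ℝ) : Prop :=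
  (∀ j < k - 1, ∀ x ∈ Set.Icc a b, DifferentiableAt ℝ (iteratedDeriv j f) x) ∧
  (∀ j ≤ k - 1, ContinuousOn (iteratedDeriv j f) (Set.Icc a b)) ∧
  (∀ x ∈ Set.Ioo a b, DifferentiableAt ℝ (iteratedDeriv (k - 1) f) x)

/-- `f` vanishes `K` times in `[a,b]`. -/
def VanishesTimes (K : ℕ) (a b : ℝ) (f : ℝ → ℝ) : Prop :=
  ∃ (n : ℕ) (x : Fin (n + 1) → ℝ) (κ : Fin (n + 1) → ℕ),
    StrictMono x ∧ (∀ i, x i ∈ Set.Icc a b) ∧ x 0 < b ∧ a < x (Fin.last n) ∧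
    (∀ i, 1 ≤ κ i) ∧ (∑ i, κ i) = K ∧
    ∀ i, ∀ j < κ i, iteratedDeriv j f (x i) = 0

/-- The quasi-differential operator `𝒲ₙ(f)(ξ) = W(w₁,…,w_{m+n},f; u₁,…,u_{m+n},0)(ξ,…,ξ)`. -/
noncomputable def Wop (m k : ℕ) (w : Fin (m + k) → ℝ → ℝ) (u : Fin (m + k) → Fin m → ℝ)
    (n : ℕ) (hn : n ≤ k) (f : ℝ → ℝ) (ξ : ℝ) : ℝ :=
  genWu m (n + 1)
    (Fin.snoc (fun i : Fin (m + n) => w (Fin.castLE (by omega) i)) f)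
    (Fin.snoc (fun i : Fin (m + n) => u (Fin.castLE (by omega) i)) 0)
    (fun _ => ξ)

/-- `Vₙ(ξ) = W(w₁,…,w_{m+n}; u₁,…,u_{m+n})(ξ,…,ξ)`, with the convention `V₀ = 0` when `m = 0`. -/
noncomputable def Vdet (m k : ℕ) (w : Fin (m + k) → ℝ → ℝ) (u : Fin (m + k) → Fin m → ℝ)
    (n : ℕ) (hn : n ≤ k) (ξ : ℝ) : ℝ :=
  if m = 0 ∧ n = 0 then 0
  else genWu m n (fun i : Fin (m + n) => w (Fin.castLE (by omega) i))
    (fun i => u (Fin.castLE (by omega) i)) (fun _ => ξ)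

/-- `g` can be differentiated `r` times within `s`. -/
def DiffTower (s : Set ℝ) : ℕ → (ℝ → ℝ) → Prop
  | 0, _ => True
  | r + 1, g => ∃ g' : ℝ → ℝ, (∀ y ∈ s, HasDerivWithinAt g (g' y) s y) ∧ DiffTower s r g'

/-- `g` can be differentiated `r` times within `s`, and all derivatives of order at most `r`
vanish at `x`. -/
def VanishTower (s : Set ℝ) (x : ℝ) : ℕ → (ℝ → ℝ) → Prop
  | 0, g => g x = 0
  | r + 1, g => g x = 0 ∧
      ∃ g' : ℝ → ℝ, (∀ y ∈ s, HasDerivWithinAt g (g' y) s y) ∧ VanishTower s x r g'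

lemma DiffTower.of_succ {s : Set ℝ} {r : ℕ} : ∀ {g : ℝ → ℝ},
    DiffTower s (r + 1) g → DiffTower s r g := by
  induction r with
  | zero => intro g _; trivial
  | succ r ih =>
    rintro g ⟨g', h, h'⟩
    exact ⟨g', h, ih h'⟩

lemma DiffTower.const (s : Set ℝ) (r : ℕ) : ∀ c : ℝ, DiffTower s r (fun _ => c) := by
  induction r with
  | zero => intro c; trivial
  | succ r ih => intro c; exact ⟨fun _ => 0, fun y _ => hasDerivWithinAt_const y s c, ih 0⟩

lemma DiffTower.add {s : Set ℝ} {r : ℕ} : ∀ {g h : ℝ → ℝ}, DiffTower s r g → DiffTower s r h →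
    DiffTower s r (fun y => g y + h y) := by
  induction r with
  | zero => intro g h _ _; trivial
  | succ r ih =>
    rintro g h ⟨g', hg, hg'⟩ ⟨h', hh, hh'⟩
    exact ⟨fun y => g' y + h' y, fun y hy => (hg y hy).add (hh y hy), ih hg' hh'⟩

lemma DiffTower.mul {s : Set ℝ} {r : ℕ} : ∀ {g h : ℝ → ℝ}, DiffTower s r g → DiffTower s r h →
    DiffTower s r (fun y => g y * h y) := by
  induction r with
  | zero => intro g h _ _; trivial
  | succ r ih =>
    intro g h tg th
    obtain ⟨g', hg, hg'⟩ := id tg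
    obtain ⟨h', hh, hh'⟩ := id th
    exact ⟨fun y => g' y * h y + g y * h' y, fun y hy => (hg y hy).mul (hh y hy),
      (ih hg' th.of_succ).add (ih tg.of_succ hh')⟩

lemma DiffTower.sum {ι : Type*} {s : Set ℝ} {r : ℕ} (t : Finset ι) {g : ι → ℝ → ℝ}
    (h : ∀ i ∈ t, DiffTower s r (g i)) : DiffTower s r (fun y => ∑ i ∈ t, g i y) := by
  classical
  induction t using Finset.induction_on with
  | empty => simpa using DiffTower.const s r 0
  | insert i t hi ih =>
    simp only [Finset.sum_insert hi]
    exact (h i (by simp)).add (ih fun j hj => h j (by simp [hj]))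

lemma DiffTower.prod {ι : Type*} {s : Set ℝ} {r : ℕ} (t : Finset ι) {g : ι → ℝ → ℝ}
    (h : ∀ i ∈ t, DiffTower s r (g i)) : DiffTower s r (fun y => ∏ i ∈ t, g i y) := by
  classical
  induction t using Finset.induction_on with
  | empty => simpa using DiffTower.const s r 1
  | insert i t hi ih =>
    simp only [Finset.prod_insert hi]
    exact (h i (by simp)).mul (ih fun j hj => h j (by simp [hj]))

lemma DiffTower.det {ι : Type*} [Fintype ι] [DecidableEq ι] {s : Set ℝ} {r : ℕ}
    {M : ℝ → Matrix ι ι ℝ} (h : ∀ i j, DiffTower s r (fun y => M y i j)) :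
    DiffTower s r (fun y => (M y).det) := by
  simp only [Matrix.det_apply']
  exact .sum _ fun σ _ => (DiffTower.const s r _).mul (.prod _ fun i _ => h _ _)

lemma VanishTower.apply_eq_zero {s : Set ℝ} {x : ℝ} {r : ℕ} {g : ℝ → ℝ}
    (h : VanishTower s x r g) : g x = 0 := by
  cases r with
  | zero => exact h
  | succ r => exact h.1

lemma VanishTower.of_succ {s : Set ℝ} {x : ℝ} {r : ℕ} : ∀ {g : ℝ → ℝ},
    VanishTower s x (r + 1) g → VanishTower s x r g := by
  induction r with
  | zero => intro g h; exact h.1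
  | succ r ih =>
    rintro g ⟨h0, g', h, h'⟩
    exact ⟨h0, g', h, ih h'⟩

lemma VanishTower.zero (s : Set ℝ) (x : ℝ) (r : ℕ) : VanishTower s x r (fun _ => 0) := by
  induction r with
  | zero => rfl
  | succ r ih => exact ⟨rfl, fun _ => 0, fun y _ => hasDerivWithinAt_const y s 0, ih⟩

lemma VanishTower.add {s : Set ℝ} {x : ℝ} {r : ℕ} : ∀ {g h : ℝ → ℝ}, VanishTower s x r g →
    VanishTower s x r h → VanishTower s x r (fun y => g y + h y) := by
  induction r with
  | zero =>
    intro g h hg hh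
    simp only [VanishTower] at *
    simp [hg, hh]
  | succ r ih =>
    rintro g h ⟨hg0, g', hg, hg'⟩ ⟨hh0, h', hh, hh'⟩
    exact ⟨by simp [hg0, hh0], fun y => g' y + h' y, fun y hy => (hg y hy).add (hh y hy),
      ih hg' hh'⟩

lemma VanishTower.mul {s : Set ℝ} {x : ℝ} {r : ℕ} : ∀ {c g : ℝ → ℝ}, DiffTower s r c →
    VanishTower s x r g → VanishTower s x r (fun y => c y * g y) := by
  induction r with
  | zero =>
    intro c g _ hg
    simp only [VanishTower] at *
    simp [hg]
  | succ r ih =>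
    intro c g tc tg
    obtain ⟨c', hc, hc'⟩ := id tc
    obtain ⟨hg0, g', hg, hg'⟩ := id tg
    exact ⟨by simp [hg0], fun y => c' y * g y + c y * g' y, fun y hy => (hc y hy).mul (hg y hy),
      (ih hc' tg.of_succ).add (ih tc.of_succ hg')⟩

lemma VanishTower.sum {ι : Type*} {s : Set ℝ} {x : ℝ} {r : ℕ} (t : Finset ι) {g : ι → ℝ → ℝ}
    (h : ∀ i ∈ t, VanishTower s x r (g i)) : VanishTower s x r (fun y => ∑ i ∈ t, g i y) := by
  classical
  induction t using Finset.induction_on with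
  | empty => simpa using VanishTower.zero s x r
  | insert i t hi ih =>
    simp only [Finset.sum_insert hi]
    exact (h i (by simp)).add (ih fun j hj => h j (by simp [hj]))

lemma uniqueDiffWithinAt_insert_Ioo {a b x y : ℝ} (hab : a < b) (hx : x ∈ Set.Icc a b)
    (hy : y ∈ insert x (Set.Ioo a b)) :
    UniqueDiffWithinAt ℝ (insert x (Set.Ioo a b)) y := by
  have hyI : y ∈ Set.Icc a b := by
    rcases hy with rfl | hy
    · exact hx
    · exact Set.Ioo_subset_Icc_self hy
  refine UniqueDiffWithinAt.mono ?_ (Set.subset_insert _ _)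
  refine uniqueDiffWithinAt_convex (convex_Ioo a b) ?_ ?_
  · rw [interior_Ioo]; exact Set.nonempty_Ioo.2 hab
  · rwa [closure_Ioo hab.ne]

/-- At an endpoint of `[a, b]` a global derivative either agrees with the one-sided one or takes
the default value `0`, so it vanishes together with the one-sided derivative. -/
lemma VanishTower.iteratedDeriv_eq_zero {a b x : ℝ} (hab : a < b) (hx : x ∈ Set.Icc a b) {r : ℕ} :
    ∀ {g h : ℝ → ℝ}, Set.EqOn h g (insert x (Set.Ioo a b)) →
      VanishTower (insert x (Set.Ioo a b)) x r g → ∀ j ≤ r, iteratedDeriv j h x = 0 := by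
  have hxs : x ∈ insert x (Set.Ioo a b) := Set.mem_insert _ _
  induction r with
  | zero =>
    intro g h hgh hg j hj
    obtain rfl : j = 0 := by omega
    simpa [hgh hxs] using hg.apply_eq_zero
  | succ r ih =>
    intro g h hgh hg j hj
    rcases j with _ | j
    · simpa [hgh hxs] using hg.apply_eq_zero
    obtain ⟨-, g', hd, hg'⟩ := hg
    rw [iteratedDeriv_succ']
    refine ih ?_ hg' j (by omega)
    intro y hy
    have hw : HasDerivWithinAt h (g' y) (insert x (Set.Ioo a b)) y :=
      (hd y hy).congr hgh (hgh hy)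
    by_cases hdiff : DifferentiableAt ℝ h y
    · exact (uniqueDiffWithinAt_insert_Ioo hab hx hy).eq_deriv _
        hdiff.hasDerivAt.hasDerivWithinAt hw
    · rw [deriv_zero_of_not_differentiableAt hdiff]
      rcases hy with rfl | hy
      · exact hg'.apply_eq_zero.symm
      · exact absurd ((hw.mono (Set.subset_insert _ _)).hasDerivAt
          (Ioo_mem_nhds hy.1 hy.2)).differentiableAt hdiff

lemma diffTower_iteratedDeriv {s : Set ℝ} {K : ℕ} {g : ℝ → ℝ}
    (h : ∀ i < K, ∀ y ∈ s, HasDerivWithinAt (iteratedDeriv i g) (iteratedDeriv (i + 1) g y) s y) :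
    ∀ r i, i + r ≤ K → DiffTower s r (iteratedDeriv i g) := by
  intro r
  induction r with
  | zero => intro i _; trivial
  | succ r ih => intro i hi; exact ⟨_, h i (by omega), ih (i + 1) (by omega)⟩

lemma vanishTower_iteratedDeriv {s : Set ℝ} {x : ℝ} {K : ℕ} {g : ℝ → ℝ}
    (h : ∀ i < K, ∀ y ∈ s, HasDerivWithinAt (iteratedDeriv i g) (iteratedDeriv (i + 1) g y) s y)
    (h0 : ∀ i ≤ K, iteratedDeriv i g x = 0) :
    ∀ r i, i + r ≤ K → VanishTower s x r (iteratedDeriv i g) := by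
  intro r
  induction r with
  | zero => intro i hi; exact h0 i (by omega)
  | succ r ih =>
    intro i hi
    exact ⟨h0 i (by omega), _, h i (by omega), ih (i + 1) (by omega)⟩

lemma MemDk.hasDerivAt {k : ℕ} {a b : ℝ} {g : ℝ → ℝ} (hg : MemDk k a b g) {i : ℕ} (hi : i < k)
    {y : ℝ} (hy : y ∈ Set.Ioo a b) :
    HasDerivAt (iteratedDeriv i g) (iteratedDeriv (i + 1) g y) y := by
  rw [iteratedDeriv_succ]
  refine DifferentiableAt.hasDerivAt ?_
  rcases Nat.lt_or_ge i (k - 1) with h | h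
  · exact hg.1 i h y (Set.Ioo_subset_Icc_self hy)
  · obtain rfl : i = k - 1 := by omega
    exact hg.2.2 y hy

/-- Differentiability up to order `k - 1` at all points, up to order `k` at interior ones. -/
lemma MemDk.hasDerivWithinAt_insert {k : ℕ} {a b : ℝ} {g : ℝ → ℝ} (hg : MemDk k a b g)
    {x : ℝ} (hx : x ∈ Set.Icc a b) {K : ℕ} (hK : K ≤ k) (hKx : K = k → x ∈ Set.Ioo a b)
    {i : ℕ} (hi : i < K) {y : ℝ} (hy : y ∈ insert x (Set.Ioo a b)) :
    HasDerivWithinAt (iteratedDeriv i g) (iteratedDeriv (i + 1) g y)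
      (insert x (Set.Ioo a b)) y := by
  refine HasDerivAt.hasDerivWithinAt ?_
  rcases hy with rfl | hy
  · rcases hK.eq_or_lt with h | h
    · exact hg.hasDerivAt (by omega) (hKx h)
    · rw [iteratedDeriv_succ]
      exact (hg.1 i (by omega) y hx).hasDerivAt
  · exact hg.hasDerivAt (by omega) hy

/-- Determinant of the columns `c` of the matrix with rows `r 0, …, r (N - 1), s`. -/
noncomputable def borderedDet (N : ℕ) (r : ℕ → ℕ → ℝ) (s : ℕ → ℝ) (c : Fin (N + 1) → ℕ) : ℝ :=
  Matrix.det (Matrix.of fun i j : Fin (N + 1) => (if (i : ℕ) < N then r i else s) (c j))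

lemma borderedDet_eq_sum (N : ℕ) (r : ℕ → ℕ → ℝ) (s : ℕ → ℝ) (c : Fin (N + 1) → ℕ) :
    borderedDet N r s c = ∑ j : Fin (N + 1), (-1) ^ (N + (j : ℕ)) *
      Matrix.det (Matrix.of fun i l : Fin N => r i (c (j.succAbove l))) * s (c j) := by
  rw [borderedDet, Matrix.det_succ_row _ (Fin.last N)]
  refine Finset.sum_congr rfl fun j _ => ?_
  have : (Matrix.of fun i j : Fin (N + 1) => (if (i : ℕ) < N then r i else s) (c j)).submatrix
      (Fin.last N).succAbove j.succAbove =
      Matrix.of fun i l : Fin N => r i (c (j.succAbove l)) := by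
    ext i l
    simp
  rw [this]
  simp only [Matrix.of_apply, Fin.val_last, lt_irrefl, if_false]
  ring

lemma borderedDet_self (N : ℕ) (r : ℕ → ℕ → ℝ) (c : Fin (N + 1) → ℕ) :
    borderedDet N r (r N) c = Matrix.det (Matrix.of fun i j : Fin (N + 1) => r i (c j)) := by
  unfold borderedDet
  congr 1
  ext i j
  by_cases h : (i : ℕ) < N
  · simp [h]
  · have : (i : ℕ) = N := by omega
    simp [this]

lemma borderedDet_row_eq_zero {N i : ℕ} (hi : i < N) (r : ℕ → ℕ → ℝ) (c : Fin (N + 1) → ℕ) :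
    borderedDet N r (r i) c = 0 := by
  refine Matrix.det_zero_of_row_eq (i := ⟨i, by omega⟩) (j := Fin.last N) ?_ ?_
  · intro h
    have := congrArg Fin.val h
    simp at this
    omega
  · ext j
    simp [hi]

lemma borderedDet_combination (N : ℕ) (r : ℕ → ℕ → ℝ) (s e : ℕ → ℝ) (c : Fin (N + 1) → ℕ)
    {ι : Type*} [Fintype ι] (d : ι → ℝ) (q : ι → ℕ → ℝ) (t : ℝ)
    (h : ∀ j, s (c j) = ∑ i, d i * q i (c j) + t * e (c j)) :
    borderedDet N r s c = ∑ i, d i * borderedDet N r (q i) c + t * borderedDet N r e c := by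
  simp only [borderedDet_eq_sum, h, mul_add, Finset.sum_add_distrib, Finset.mul_sum]
  rw [Finset.sum_comm]
  congr 1
  · exact Finset.sum_congr rfl fun i _ => Finset.sum_congr rfl fun j _ => by ring
  · exact Finset.sum_congr rfl fun i _ => by ring

lemma borderedDet_unit (N : ℕ) (r : ℕ → ℕ → ℝ) (e : ℕ → ℝ) (c : Fin (N + 1) → ℕ)
    (he : ∀ j : Fin N, e (c j.castSucc) = 0) (he' : e (c (Fin.last N)) = 1) :
    borderedDet N r e c = Matrix.det (Matrix.of fun i j : Fin N => r i (c j.castSucc)) := by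
  rw [borderedDet_eq_sum, Fin.sum_univ_castSucc, Finset.sum_eq_zero fun j _ => by simp [he j]]
  simp [he', ← two_mul]

/-- A three-term determinant identity of Sylvester type. -/
lemma borderedDet_sylvester (N : ℕ) (r : ℕ → ℕ → ℝ) (s : ℕ → ℝ) (c' : Fin (N + 1) → ℕ)
    (hc : ∀ j : Fin N, c' j.castSucc = j) (hc' : c' (Fin.last N) = N + 1)
    (hV : borderedDet N r (r N) (fun j => j) ≠ 0) :
    borderedDet N r s c' * borderedDet N r (r N) (fun j => j) -
      borderedDet N r s (fun j => j) * borderedDet N r (r N) c' =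
    borderedDet (N + 1) r s (fun j => j) *
      Matrix.det (Matrix.of fun i j : Fin N => r i j) := by
  classical
  set P : Matrix (Fin (N + 1)) (Fin (N + 1)) ℝ := Matrix.of fun i j => r i j with hP
  have hdet : P.det ≠ 0 := by rwa [borderedDet_self] at hV
  obtain ⟨d, hd⟩ : ∃ d : Fin (N + 1) → ℝ, ∀ j : Fin (N + 1), s j = ∑ i, d i * r i j := by
    have hu : IsUnit P.det := isUnit_iff_ne_zero.2 hdet
    refine ⟨Matrix.vecMul (fun j : Fin (N + 1) => s j) P⁻¹, fun j => ?_⟩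
    have h := congrFun (Matrix.vecMul_vecMul (fun j : Fin (N + 1) => s j) P⁻¹ P) j
    rw [Matrix.nonsing_inv_mul _ hu, Matrix.vecMul_one] at h
    rw [← h]
    rfl
  set e : ℕ → ℝ := fun j => if j = N + 1 then 1 else 0 with he
  set t : ℝ := s (N + 1) - ∑ i, d i * r i (N + 1) with ht
  have key : ∀ j ≤ N + 1, s j = ∑ i, d i * r i j + t * e j := by
    intro j hj
    rcases hj.eq_or_lt with rfl | hj
    · simp [he, ht]
    · have := hd ⟨j, hj⟩
      simp only at this
      simp [he, this, hj.ne]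
  have hA : borderedDet N r s (fun j => j) =
      d (Fin.last N) * borderedDet N r (r N) (fun j => j) := by
    rw [borderedDet_combination N r s e _ d (fun i => r i) t fun j => key _ (by omega),
      Fin.sum_univ_castSucc, Finset.sum_eq_zero fun i _ => by
        rw [borderedDet_row_eq_zero (by simp)]; simp]
    have : borderedDet N r e (fun j => j) = 0 := by
      rw [borderedDet_eq_sum]
      refine Finset.sum_eq_zero fun j _ => ?_
      have : (j : ℕ) ≠ N + 1 := by omega
      simp [he, this]
    simp [this]
  have hc'le : ∀ j, c' j ≤ N + 1 := by
    intro j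
    refine Fin.lastCases ?_ (fun j => ?_) j
    · exact hc'.le
    · rw [hc]; omega
  have hA' : borderedDet N r s c' = d (Fin.last N) * borderedDet N r (r N) c' +
      t * Matrix.det (Matrix.of fun i j : Fin N => r i j) := by
    rw [borderedDet_combination N r s e _ d (fun i => r i) t fun j => key _ (hc'le j),
      Fin.sum_univ_castSucc, Finset.sum_eq_zero fun i _ => by
        rw [borderedDet_row_eq_zero (by simp)]; simp]
    rw [borderedDet_unit N r e c' (fun j => ?_) (by simp [he, hc'])]
    · simp [hc]
    · have : (j : ℕ) ≠ N + 1 := by omega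
      simp [he, hc, this]
  have hphi : borderedDet (N + 1) r s (fun j => j) =
      t * borderedDet N r (r N) (fun j => j) := by
    rw [borderedDet_combination (N + 1) r s e _ d (fun i => r i) t fun j => key _ (by omega),
      Finset.sum_eq_zero fun i _ => by
        rw [borderedDet_row_eq_zero i.isLt]; simp]
    rw [borderedDet_unit (N + 1) r e _ (fun j => ?_) (by simp [he]), borderedDet_self]
    · simp
    · have : (j : ℕ) ≠ N + 1 := by omega
      simp [he, this]
  rw [hA, hA', hphi]
  ring

lemma hasDerivAt_det {ι : Type*} [Fintype ι] [DecidableEq ι] {M : ℝ → Matrix ι ι ℝ}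
    {M' : Matrix ι ι ℝ} {ξ : ℝ} (h : ∀ i j, HasDerivAt (fun y => M y i j) (M' i j) ξ) :
    HasDerivAt (fun y => (M y).det) (∑ j, ((M ξ).updateCol j fun i => M' i j).det) ξ := by
  simp only [Matrix.det_apply']
  rw [Finset.sum_comm]
  refine HasDerivAt.fun_sum fun σ _ => ?_
  rw [← Finset.mul_sum]
  refine HasDerivAt.const_mul _ ?_
  have := HasDerivAt.fun_finsetProd (u := Finset.univ) (f := fun i y => M y (σ i) i)
    (f' := fun i => M' (σ i) i) (x := ξ) fun i _ => h _ _
  refine this.congr_deriv (Finset.sum_congr rfl fun j _ => ?_)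
  rw [← Finset.prod_erase_mul _ _ (Finset.mem_univ j), smul_eq_mul]
  congr 1
  · refine Finset.prod_congr rfl fun i hi => ?_
    rw [Matrix.updateCol_ne (Finset.ne_of_mem_erase hi)]
  · simp

/-- Differentiating a determinant with constant columns followed by successive derivatives only
affects the last column. -/
lemma hasDerivAt_borderedDet {m N : ℕ} (hm : m ≤ N) {r : ℝ → ℕ → ℕ → ℝ} {s : ℝ → ℕ → ℝ}
    {ξ : ℝ} {c' : Fin (N + 1) → ℕ}
    (hc : ∀ j : Fin N, c' j.castSucc = j) (hc' : c' (Fin.last N) = N + 1)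
    (hr : ∀ i < N, ∀ j ≤ N, HasDerivAt (fun y => r y i j) (if j < m then 0 else r ξ i (j + 1)) ξ)
    (hs : ∀ j ≤ N, HasDerivAt (fun y => s y j) (if j < m then 0 else s ξ (j + 1)) ξ) :
    HasDerivAt (fun y => borderedDet N (r y) (s y) (fun j => j))
      (borderedDet N (r ξ) (s ξ) c') ξ := by
  have h : ∀ i j : Fin (N + 1), HasDerivAt
      (fun y => (Matrix.of fun i j : Fin (N + 1) => (if (i : ℕ) < N then r y i else s y) j) i j)
      ((Matrix.of fun i j : Fin (N + 1) => if (j : ℕ) < m then 0 else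
        (if (i : ℕ) < N then r ξ i else s ξ) (j + 1)) i j) ξ := by
    intro i j
    by_cases hi : (i : ℕ) < N
    · simpa [hi] using hr i hi j (by omega)
    · simpa [hi] using hs j (by omega)
  refine (hasDerivAt_det h).congr_deriv ?_
  rw [Fin.sum_univ_castSucc, Finset.sum_eq_zero fun j _ => ?_, zero_add]
  · unfold borderedDet
    congr 1
    ext i j
    refine Fin.lastCases ?_ (fun j => ?_) j
    · simp [hc', not_lt.2 hm]
    · rw [Matrix.updateCol_ne (Fin.castSucc_lt_last j).ne]
      simp [hc]
  · by_cases hj : (j : ℕ) < m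
    · refine Matrix.det_eq_zero_of_column_eq_zero j.castSucc fun i => ?_
      simp [hj]
    · refine Matrix.det_zero_of_column_eq (i := j.castSucc) (j := j.succ)
        (Fin.castSucc_lt_succ).ne fun i => ?_
      rw [Matrix.updateCol_self, Matrix.updateCol_ne (Fin.castSucc_lt_succ).ne']
      simp [hj]

/-- A row `(v, g(ξ), g'(ξ), …)` of a generalized Wronskian, indexed by natural numbers. -/
noncomputable def wronskianRow {m : ℕ} (v : Fin m → ℝ) (g : ℝ → ℝ) (ξ : ℝ) (j : ℕ) : ℝ :=
  if h : j < m then v ⟨j, h⟩ else iteratedDeriv (j - m) g ξ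

/-- The rows attached to the system `w`, `u`, extended by zero to all natural indices. -/
noncomputable def systemRow {m k : ℕ} (w : Fin (m + k) → ℝ → ℝ) (u : Fin (m + k) → Fin m → ℝ)
    (ξ : ℝ) (i : ℕ) : ℕ → ℝ :=
  if h : i < m + k then wronskianRow (u ⟨i, h⟩) (w ⟨i, h⟩) ξ else 0

lemma multBefore_const {k : ℕ} (ξ : ℝ) (j : Fin k) : multBefore (fun _ : Fin k => ξ) j = j := by
  simp [multBefore, Fintype.card_subtype, Finset.filter_gt_eq_Iio]

lemma genWu_const (m k : ℕ) (w : Fin (m + k) → ℝ → ℝ) (u : Fin (m + k) → Fin m → ℝ) (ξ : ℝ) :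
    genWu m k w u (fun _ => ξ) =
      Matrix.det (Matrix.of fun i j : Fin (m + k) => wronskianRow (u i) (w i) ξ j) := by
  unfold genWu
  congr 1
  ext i j
  refine Fin.addCases (fun j => ?_) (fun j => ?_) j
  · simp [wronskianRow]
  · simp [wronskianRow, multBefore_const]

lemma genWu_castLE {m k n : ℕ} (hn : m + n ≤ m + k) (w : Fin (m + k) → ℝ → ℝ)
    (u : Fin (m + k) → Fin m → ℝ) (ξ : ℝ) :
    genWu m n (fun i => w (Fin.castLE hn i)) (fun i => u (Fin.castLE hn i)) (fun _ => ξ) =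
      Matrix.det (Matrix.of fun i j : Fin (m + n) => systemRow w u ξ i j) := by
  rw [genWu_const]
  congr 1
  ext i j
  have : (i : ℕ) < m + k := by omega
  simp [systemRow, this, Fin.castLE]

lemma Wop_eq_borderedDet {m k : ℕ} (w : Fin (m + k) → ℝ → ℝ) (u : Fin (m + k) → Fin m → ℝ)
    (n : ℕ) (hn : n ≤ k) (f : ℝ → ℝ) (ξ : ℝ) :
    Wop m k w u n hn f ξ = borderedDet (m + n) (systemRow w u ξ)
      (wronskianRow (0 : Fin m → ℝ) f ξ) (fun j => j) := by
  unfold Wop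
  rw [genWu_const]
  unfold borderedDet
  congr 1
  ext i j
  by_cases h : (i : ℕ) < m + n
  · have h' : (i : ℕ) < m + k := by omega
    simp [Fin.snoc, systemRow, h, h', Fin.castLE]
  · simp [Fin.snoc, h]

lemma hasDerivAt_wronskianRow {m k : ℕ} {a b : ℝ} {g : ℝ → ℝ} (hg : MemDk k a b g)
    (v : Fin m → ℝ) {ξ : ℝ} (hξ : ξ ∈ Set.Ioo a b) {j : ℕ} (hj : j < m + k) :
    HasDerivAt (fun y => wronskianRow v g y j)
      (if j < m then 0 else wronskianRow v g ξ (j + 1)) ξ := by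
  by_cases h : j < m
  · simpa [wronskianRow, h] using hasDerivAt_const ξ (v ⟨j, h⟩)
  · have h' : ¬ j + 1 < m := by omega
    have e : j + 1 - m = j - m + 1 := by omega
    simpa [wronskianRow, h, h', e] using hg.hasDerivAt (i := j - m) (by omega) hξ

lemma continuousOn_wronskianRow {m k : ℕ} {a b : ℝ} {g : ℝ → ℝ} (hg : MemDk k a b g)
    (v : Fin m → ℝ) {j : ℕ} (hj : j < m + k) :
    ContinuousOn (fun y => wronskianRow v g y j) (Set.Icc a b) := by
  by_cases h : j < m
  · simpa [wronskianRow, h] using continuousOn_const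
  · simpa [wronskianRow, h] using hg.2.1 (j - m) (by omega)

lemma hasDerivAt_systemRow {m k : ℕ} {a b : ℝ} {w : Fin (m + k) → ℝ → ℝ}
    (hw : ∀ i, MemDk k a b (w i)) (u : Fin (m + k) → Fin m → ℝ) {ξ : ℝ} (hξ : ξ ∈ Set.Ioo a b)
    (i : ℕ) {j : ℕ} (hj : j < m + k) :
    HasDerivAt (fun y => systemRow w u y i j)
      (if j < m then 0 else systemRow w u ξ i (j + 1)) ξ := by
  by_cases h : i < m + k
  · simpa [systemRow, h] using hasDerivAt_wronskianRow (hw ⟨i, h⟩) (u ⟨i, h⟩) hξ hj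
  · simpa [systemRow, h] using hasDerivAt_const ξ (0 : ℝ)

lemma continuousOn_systemRow {m k : ℕ} {a b : ℝ} {w : Fin (m + k) → ℝ → ℝ}
    (hw : ∀ i, MemDk k a b (w i)) (u : Fin (m + k) → Fin m → ℝ) (i : ℕ) {j : ℕ} (hj : j < m + k) :
    ContinuousOn (fun y => systemRow w u y i j) (Set.Icc a b) := by
  by_cases h : i < m + k
  · simpa [systemRow, h] using continuousOn_wronskianRow (hw ⟨i, h⟩) (u ⟨i, h⟩) hj
  · simpa [systemRow, h] using continuousOn_const

lemma continuousOn_borderedDet {N : ℕ} {r : ℝ → ℕ → ℕ → ℝ} {s : ℝ → ℕ → ℝ} {S : Set ℝ}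
    (hr : ∀ i, ∀ j ≤ N, ContinuousOn (fun y => r y i j) S)
    (hs : ∀ j ≤ N, ContinuousOn (fun y => s y j) S) :
    ContinuousOn (fun y => borderedDet N (r y) (s y) (fun j => j)) S := by
  simp only [borderedDet, Matrix.det_apply', Matrix.of_apply]
  refine continuousOn_finsetSum _ fun σ _ => continuousOn_const.mul
    (continuousOn_finsetProd _ fun j _ => ?_)
  by_cases h : ((σ j : Fin (N + 1)) : ℕ) < N
  · simpa [h] using hr (σ j) j (by omega)
  · simpa [h] using hs j (by omega)

/-- Rolle's theorem for the quasi-differential operators. -/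
lemma exists_Wop_succ_eq_zero {m k n : ℕ} {a b : ℝ} {w : Fin (m + k) → ℝ → ℝ}
    {u : Fin (m + k) → Fin m → ℝ} (hw : ∀ i, MemDk k a b (w i))
    (hV : ∀ n ≤ k, ∀ ξ ∈ Set.Icc a b,
      Matrix.det (Matrix.of fun i j : Fin (m + n) => systemRow w u ξ i j) ≠ 0)
    {f : ℝ → ℝ} (hf : MemDk k a b f) (hn : n + 1 ≤ k) {y z : ℝ} (hyz : y < z)
    (hy : y ∈ Set.Icc a b) (hz : z ∈ Set.Icc a b)
    (hy0 : Wop m k w u n (by omega) f y = 0) (hz0 : Wop m k w u n (by omega) f z = 0) :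
    ∃ c ∈ Set.Ioo y z, Wop m k w u (n + 1) hn f c = 0 := by
  simp only [Wop_eq_borderedDet] at hy0 hz0 ⊢
  set r := systemRow w u
  set s := wronskianRow (0 : Fin m → ℝ) f
  set A : ℝ → ℝ := fun ξ => borderedDet (m + n) (r ξ) (s ξ) (fun j => j) with hA
  set B : ℝ → ℝ := fun ξ => borderedDet (m + n) (r ξ) (r ξ (m + n)) (fun j => j) with hB
  have hB0 : ∀ ξ ∈ Set.Icc a b, B ξ ≠ 0 := fun ξ hξ => by
    simp only [hB, borderedDet_self]
    exact hV (n + 1) hn ξ hξ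
  set c' : Fin (m + n + 1) → ℕ := Fin.snoc (fun j : Fin (m + n) => (j : ℕ)) (m + n + 1)
  have hc : ∀ j : Fin (m + n), c' j.castSucc = j := fun j => by simp [c']
  have hc' : c' (Fin.last (m + n)) = m + n + 1 := by simp [c']
  have hsub : Set.Icc y z ⊆ Set.Icc a b := Set.Icc_subset_Icc hy.1 hz.2
  have hsub' : Set.Ioo y z ⊆ Set.Ioo a b := Set.Ioo_subset_Ioo hy.1 hz.2
  have hAc : ContinuousOn A (Set.Icc a b) := continuousOn_borderedDet
    (fun i j hj => continuousOn_systemRow hw u i (by omega))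
    (fun j hj => continuousOn_wronskianRow hf 0 (by omega))
  have hBc : ContinuousOn B (Set.Icc a b) := continuousOn_borderedDet
    (fun i j hj => continuousOn_systemRow hw u i (by omega))
    (fun j hj => continuousOn_systemRow hw u (m + n) (by omega))
  have hAd : ∀ ξ ∈ Set.Ioo a b, HasDerivAt A (borderedDet (m + n) (r ξ) (s ξ) c') ξ :=
    fun ξ hξ => hasDerivAt_borderedDet (m := m) (by omega) hc hc'
      (fun i _ j hj => hasDerivAt_systemRow hw u hξ i (by omega))
      (fun j hj => hasDerivAt_wronskianRow hf 0 hξ (by omega))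
  have hBd : ∀ ξ ∈ Set.Ioo a b, HasDerivAt B (borderedDet (m + n) (r ξ) (r ξ (m + n)) c') ξ :=
    fun ξ hξ => hasDerivAt_borderedDet (m := m) (by omega) hc hc'
      (fun i _ j hj => hasDerivAt_systemRow hw u hξ i (by omega))
      (fun j hj => hasDerivAt_systemRow hw u hξ (m + n) (by omega))
  obtain ⟨c, hcI, hc0⟩ := exists_hasDerivAt_eq_zero (f := fun ξ => A ξ / B ξ) hyz
    ((hAc.div hBc hB0).mono hsub) (by simp [hA, hy0, hz0])
    (fun ξ hξ => (hAd ξ (hsub' hξ)).div (hBd ξ (hsub' hξ))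
      (hB0 ξ (hsub (Set.Ioo_subset_Icc_self hξ))))
  refine ⟨c, hcI, ?_⟩
  have hcI' : c ∈ Set.Icc a b := hsub (Set.Ioo_subset_Icc_self hcI)
  rw [div_eq_zero_iff, or_iff_left (pow_ne_zero 2 (hB0 c hcI'))] at hc0
  have hid := borderedDet_sylvester (m + n) (r c) (s c) c' hc hc' (hB0 c hcI')
  have := hid.symm.trans hc0
  exact (mul_eq_zero.1 this).resolve_right (hV n (by omega) c hcI')

lemma exists_finset_interleaved {P : ℝ → Prop} (Z : Finset ℝ) (hZ : Z.Nonempty)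
    (hP : ∀ y ∈ Z, ∀ z ∈ Z, y < z → ∃ c ∈ Set.Ioo y z, P c) :
    ∃ R : Finset ℝ, R.card + 1 = Z.card ∧ Disjoint R Z ∧
      ∀ c ∈ R, (∃ y ∈ Z, y < c) ∧ (∃ z ∈ Z, c < z) ∧ P c := by
  induction Z using Finset.induction_on_max with
  | empty => exact absurd hZ (by simp)
  | insert z Z hz ih =>
    rcases Z.eq_empty_or_nonempty with rfl | hne
    · exact ⟨∅, by simp⟩
    have hzZ : z ∉ Z := fun h => (hz z h).false
    obtain ⟨R, hcard, hdisj, hR⟩ := ih hne fun y hy z hz =>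
      hP y (Finset.mem_insert_of_mem hy) z (Finset.mem_insert_of_mem hz)
    have hmax := Z.max'_mem hne
    obtain ⟨c, hc, hPc⟩ := hP _ (Finset.mem_insert_of_mem hmax) z (Finset.mem_insert_self _ _)
      (hz _ hmax)
    have hle : ∀ y ∈ Z, y ≤ Z.max' hne := fun y hy => Z.le_max' y hy
    have hRlt : ∀ y ∈ R, y < Z.max' hne := fun y hy => by
      obtain ⟨-, ⟨t, ht, hyt⟩, -⟩ := hR y hy
      exact hyt.trans_le (hle t ht)
    have hcR : c ∉ R := fun h => ((hRlt c h).trans hc.1).false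
    have hcZ : c ∉ Z := fun h => ((hle c h).trans_lt hc.1).false
    have hzR : z ∉ R := fun h => ((hRlt z h).trans (hz _ hmax)).false
    refine ⟨insert c R, ?_, ?_, ?_⟩
    · rw [Finset.card_insert_of_notMem hcR, Finset.card_insert_of_notMem hzZ, hcard]
    · rw [Finset.disjoint_insert_left, Finset.disjoint_insert_right]
      refine ⟨?_, hzR, hdisj⟩
      rw [Finset.mem_insert, not_or]
      exact ⟨hc.2.ne, hcZ⟩
    · intro y hy
      rcases Finset.mem_insert.1 hy with rfl | hy
      · exact ⟨⟨_, Finset.mem_insert_of_mem hmax, hc.1⟩, ⟨z, Finset.mem_insert_self _ _, hc.2⟩,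
          hPc⟩
      · obtain ⟨⟨p, hp, hp'⟩, ⟨q, hq, hq'⟩, h⟩ := hR y hy
        exact ⟨⟨p, Finset.mem_insert_of_mem hp, hp'⟩, ⟨q, Finset.mem_insert_of_mem hq, hq'⟩, h⟩

/-- A zero of `f` of multiplicity `K + 1` is a zero of `𝒲ₙ(f)` of multiplicity `K + 1 - n`. -/
lemma iteratedDeriv_Wop_eq_zero {m k n : ℕ} {a b : ℝ} (hab : a < b) {w : Fin (m + k) → ℝ → ℝ}
    {u : Fin (m + k) → Fin m → ℝ} (hw : ∀ i, MemDk k a b (w i)) {f : ℝ → ℝ} (hf : MemDk k a b f)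
    (hn : n ≤ k) {x : ℝ} (hx : x ∈ Set.Icc a b) {K : ℕ} (hK : K ≤ k)
    (hKx : K = k → x ∈ Set.Ioo a b) (hf0 : ∀ i ≤ K, iteratedDeriv i f x = 0) {j : ℕ}
    (hj : j + n ≤ K) : iteratedDeriv j (fun ξ => Wop m k w u n hn f ξ) x = 0 := by
  refine VanishTower.iteratedDeriv_eq_zero (r := j) hab hx (fun _ _ => rfl) ?_ j le_rfl
  simp only [Wop_eq_borderedDet, borderedDet_eq_sum]
  refine VanishTower.sum _ fun l _ => VanishTower.mul ((DiffTower.const _ _ _).mul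
    (DiffTower.det fun p q => ?_)) ?_
  · have hp : (p : ℕ) < m + k := by omega
    by_cases hq : ((l.succAbove q : Fin (m + n + 1)) : ℕ) < m
    · simpa [systemRow, wronskianRow, hp, hq] using DiffTower.const _ _ _
    · simpa [systemRow, wronskianRow, hp, hq] using diffTower_iteratedDeriv
        (fun i hi y hy => (hw ⟨p, hp⟩).hasDerivWithinAt_insert hx hK hKx hi hy) j _ (by omega)
  · by_cases hl : (l : ℕ) < m
    · simpa [wronskianRow, hl] using VanishTower.zero _ _ _
    · simpa [wronskianRow, hl] using vanishTower_iteratedDeriv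
        (fun i hi y hy => hf.hasDerivWithinAt_insert hx hK hKx hi hy) hf0 j _ (by omega)

lemma sum_tsub_succ {ι : Type*} [Fintype ι] (κ : ι → ℕ) (n : ℕ) :
    ∑ i, (κ i - (n + 1)) = (Finset.univ.filter fun i => n + 1 < κ i).card +
      ∑ i, (κ i - (n + 2)) := by
  rw [Finset.card_filter, ← Finset.sum_add_distrib]
  refine Finset.sum_congr rfl fun i _ => ?_
  split_ifs <;> omega

/-- A finite set of zeros together with multiplicities at some of its points yields the required
number of zeros. -/
lemma vanishesTimes_of_finset {a b : ℝ} {g : ℝ → ℝ} {ι : Type*} [Fintype ι] {x : ι → ℝ}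
    (hx : Function.Injective x) (κ : ι → ℕ) (Z : Finset ℝ) (hZ : ∀ z ∈ Z, z ∈ Set.Icc a b)
    (hZa : ∃ z ∈ Z, a < z) (hZb : ∃ z ∈ Z, z < b) (hxZ : ∀ i, 0 < κ i → x i ∈ Z)
    (hg : ∀ z ∈ Z, g z = 0) (hgx : ∀ i, ∀ j ≤ κ i, 0 < j → iteratedDeriv j g (x i) = 0) :
    VanishesTimes (Z.card + ∑ i, κ i) a b g := by
  classical
  obtain ⟨za, hza, hza'⟩ := hZa
  obtain ⟨zb, hzb, hzb'⟩ := hZb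
  have hne : Z.Nonempty := ⟨za, hza⟩
  obtain ⟨N, hN⟩ : ∃ N, Z.card = N + 1 := ⟨Z.card - 1, by have := hne.card_pos; omega⟩
  set ν : ℝ → ℕ := Function.extend x κ 0 with hν
  have hνx : ∀ i, ν (x i) = κ i := fun i => hx.extend_apply κ 0 i
  have hν0 : ∀ z, (¬ ∃ i, x i = z) → ν z = 0 := fun z hz => by
    rw [hν, Function.extend_apply' _ _ _ hz]; rfl
  have hsum : ∑ z ∈ Z, ν z = ∑ i, κ i := by
    rw [Finset.sum_subset (Finset.subset_union_left (s₂ := Finset.univ.image x)),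
      ← Finset.sum_subset (Finset.subset_union_right (s₁ := Z)),
      Finset.sum_image fun i _ j _ h => hx h]
    · exact Finset.sum_congr rfl fun i _ => hνx i
    · intro z _ hz
      exact hν0 z fun ⟨i, hi⟩ => hz (by simp [← hi])
    · intro z _ hz
      by_contra h
      by_cases hz' : ∃ i, x i = z
      · obtain ⟨i, rfl⟩ := hz'
        exact hz (hxZ i (by rw [← hνx]; omega))
      · exact h (hν0 z hz')
  set p := Z.orderEmbOfFin hN
  have hp : ∀ i, p i ∈ Z := Z.orderEmbOfFin_mem hN
  have hsurj : ∀ z ∈ Z, ∃ i, p i = z := fun z hz => by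
    have : z ∈ Set.range p := by rw [Z.range_orderEmbOfFin hN]; exact hz
    exact this
  refine ⟨N, p, fun i => 1 + ν (p i), p.strictMono, fun i => hZ _ (hp i), ?_, ?_,
    fun i => Nat.le_add_right 1 _, ?_, ?_⟩
  · obtain ⟨i, hi⟩ := hsurj zb hzb
    exact (p.monotone (Fin.zero_le i)).trans_lt (hi ▸ hzb')
  · obtain ⟨i, hi⟩ := hsurj za hza
    exact lt_of_lt_of_le (hi ▸ hza') (p.monotone (Fin.le_last i))
  · have h := Finset.sum_map Finset.univ p.toEmbedding ν
    rw [Finset.map_orderEmbOfFin_univ Z hN, hsum] at h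
    rw [Finset.sum_add_distrib, h]
    simp [hN, p]
  · intro i j hj
    change j < 1 + ν (p i) at hj
    rcases Nat.eq_zero_or_pos j with rfl | hj0
    · simpa using hg _ (hp i)
    · by_cases hz : ∃ l, x l = p i
      · obtain ⟨l, hl⟩ := hz
        rw [← hl, hνx] at hj
        rw [← hl]
        exact hgx l j (by omega) hj0
      · rw [hν0 _ hz] at hj
        omega

/-- **Lemma 4**: if `f` vanishes `k+1` times in `[a,b]`, then `𝒲ₙ(f)` vanishes
`k+1-n` times in `[a,b]`, for each `0 ≤ n ≤ k`. -/
theorem Wop_vanishes (k m : ℕ) (hk : 1 ≤ k) (a b : ℝ) (hab : a < b)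
    (u : Fin (m + k) → Fin m → ℝ)
    (hu : 0 < m → Matrix.det (Matrix.of fun i j : Fin m => u (Fin.castAdd k i) j) ≠ 0)
    (w : Fin (m + k) → ℝ → ℝ) (hw : ∀ i, MemDk k a b (w i))
    (hV : ∀ n, 1 ≤ n → ∀ hn : n ≤ k, ∀ ξ ∈ Set.Icc a b,
      genWu m n (fun i => w (Fin.castLE (by omega) i))
        (fun i => u (Fin.castLE (by omega) i)) (fun _ => ξ) ≠ 0)
    (f : ℝ → ℝ) (hf : MemDk k a b f) (hvan : VanishesTimes (k + 1) a b f) :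
    ∀ n, ∀ hn : n ≤ k, VanishesTimes (k + 1 - n) a b (fun ξ => Wop m k w u n hn f ξ) := by
  obtain ⟨N, x, κ, hx, hxI, hx0, hxl, hκ, hsum, hvan⟩ := hvan
  have hdet : ∀ n ≤ k, ∀ ξ ∈ Set.Icc a b,
      Matrix.det (Matrix.of fun i j : Fin (m + n) => systemRow w u ξ i j) ≠ 0 := by
    intro n hn ξ hξ
    rcases Nat.eq_zero_or_pos n with rfl | hn0
    · rcases Nat.eq_zero_or_pos m with rfl | hm
      · have : IsEmpty (Fin (0 + 0)) := inferInstanceAs (IsEmpty (Fin 0))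
        rw [Matrix.det_isEmpty]
        exact one_ne_zero
      · have hrows : (Matrix.of fun i j : Fin m => systemRow w u ξ i j) =
            Matrix.of fun i j : Fin m => u (Fin.castAdd k i) j := by
          ext i j
          have : (i : ℕ) < m + k := by omega
          simp [systemRow, wronskianRow, this, Fin.castAdd, Fin.castLE]
        have h := hu hm
        rwa [← hrows] at h
    · rw [← genWu_castLE (by omega)]
      exact hV n hn0 hn ξ hξ
  have hpair : ∀ i l, l ≠ i → κ i + κ l ≤ k + 1 := fun i l hl => by
    rw [← hsum, ← Finset.add_sum_erase _ _ (Finset.mem_univ i)]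
    exact Nat.add_le_add_left (Finset.single_le_sum (fun _ _ => Nat.zero_le _)
      (Finset.mem_erase.2 ⟨hl, Finset.mem_univ l⟩)) _
  have hκle : ∀ i, κ i ≤ k + 1 := fun i => by
    rw [← hsum]
    exact Finset.single_le_sum (fun _ _ => Nat.zero_le _) (Finset.mem_univ i)
  have hmult : ∀ n, ∀ hn : n ≤ k, ∀ i j, j + n < κ i →
      iteratedDeriv j (fun ξ => Wop m k w u n hn f ξ) (x i) = 0 := by
    intro n hn i j hj
    refine iteratedDeriv_Wop_eq_zero hab hw hf hn (hxI i) (K := κ i - 1)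
      (by have := hκle i; omega) (fun hK => ?_) (fun l hl => hvan i l (by omega)) (by omega)
    have honly : ∀ l, l = i := fun l => by
      by_contra hl
      have := hpair i l hl
      have := hκ l
      omega
    exact ⟨honly (Fin.last N) ▸ hxl, honly 0 ▸ hx0⟩
  have hzeros : ∀ n, ∀ hn : n ≤ k, ∃ Z : Finset ℝ,
      (∀ z ∈ Z, z ∈ Set.Icc a b) ∧ (∀ z ∈ Z, Wop m k w u n hn f z = 0) ∧
      (∀ i, n < κ i → x i ∈ Z) ∧ Z.card + ∑ i, (κ i - (n + 1)) = k + 1 - n ∧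
      (∃ z ∈ Z, a < z) ∧ ∃ z ∈ Z, z < b := by
    intro n
    induction n with
    | zero =>
      intro hn
      refine ⟨Finset.univ.map ⟨x, hx.injective⟩, ?_, ?_, by simp, ?_, ⟨_, by simp, hxl⟩,
        ⟨_, by simp, hx0⟩⟩
      · simpa using hxI
      · intro z hz
        obtain ⟨i, -, rfl⟩ := Finset.mem_map.1 hz
        exact hmult 0 hn i 0 (hκ i)
      · rw [Finset.card_map, Nat.sub_zero, ← hsum, Finset.card_eq_sum_ones,
          ← Finset.sum_add_distrib]
        exact Finset.sum_congr rfl fun i _ => by have := hκ i; omega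
    | succ n ih =>
      intro hn
      obtain ⟨Z, hZI, hZ0, hxZ, hcard, ⟨za, hza, hza'⟩, ⟨zb, hzb, hzb'⟩⟩ := ih (by omega)
      obtain ⟨R, hRcard, hRZ, hR⟩ := exists_finset_interleaved
        (P := fun c => Wop m k w u (n + 1) hn f c = 0) Z ⟨za, hza⟩
        fun y hy z hz hyz => exists_Wop_succ_eq_zero hw hdet hf hn hyz (hZI y hy) (hZI z hz)
          (hZ0 y hy) (hZ0 z hz)
      have hRI : ∀ c ∈ R, c ∈ Set.Ioo a b := fun c hc => by
        obtain ⟨⟨y, hy, hyc⟩, ⟨z, hz, hcz⟩, -⟩ := hR c hc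
        exact ⟨(hZI y hy).1.trans_lt hyc, hcz.trans_le (hZI z hz).2⟩
      set T := (Finset.univ.filter fun i => n + 1 < κ i).map ⟨x, hx.injective⟩ with hT
      have hTmem : ∀ z ∈ T, ∃ i, n + 1 < κ i ∧ x i = z := by simp [hT]
      have hTZ : T ⊆ Z := fun z hz => by
        obtain ⟨i, hi, rfl⟩ := hTmem z hz
        exact hxZ i (by omega)
      have hTcard : ∑ i, (κ i - (n + 1)) = T.card + ∑ i, (κ i - (n + 2)) := by
        rw [hT, Finset.card_map]
        exact sum_tsub_succ κ n
      have hinterior : ∃ c ∈ R ∪ T, c ∈ Set.Ioo a b ∨ (c = za ∧ c = zb) := by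
        rcases R.eq_empty_or_nonempty with hRe | ⟨c, hc⟩
        · have hone : Z.card = 1 := by rw [← hRcard, hRe]; rfl
          obtain ⟨z, rfl⟩ := Finset.card_eq_one.1 hone
          have hpos : ∑ i, (κ i - (n + 1)) ≠ 0 := by omega
          obtain ⟨i, -, hi⟩ := Finset.exists_ne_zero_of_sum_ne_zero hpos
          have hxi := hxZ i (by omega)
          simp only [Finset.mem_singleton] at hza hzb hxi
          refine ⟨x i, Finset.mem_union_right _ ?_, Or.inr ⟨by rw [hxi, hza], by rw [hxi, hzb]⟩⟩
          simp only [hT, Finset.mem_map, Finset.mem_filter, Finset.mem_univ, true_and,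
            Function.Embedding.coeFn_mk]
          exact ⟨i, by omega, rfl⟩
        · exact ⟨c, Finset.mem_union_left _ hc, Or.inl (hRI c hc)⟩
      refine ⟨R ∪ T, ?_, ?_, ?_, ?_, ?_, ?_⟩
      · intro z hz
        rcases Finset.mem_union.1 hz with hz | hz
        · exact Set.Ioo_subset_Icc_self (hRI z hz)
        · exact hZI z (hTZ hz)
      · intro z hz
        rcases Finset.mem_union.1 hz with hz | hz
        · exact (hR z hz).2.2
        · obtain ⟨i, hi, rfl⟩ := hTmem z hz
          exact hmult (n + 1) hn i 0 (by omega)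
      · intro i hi
        refine Finset.mem_union_right _ ?_
        simpa [hT, hx.injective.eq_iff] using hi
      · rw [Finset.card_union_of_disjoint (Finset.disjoint_of_subset_right hTZ hRZ)]
        show R.card + T.card + ∑ i, (κ i - (n + 2)) = _
        omega
      · obtain ⟨c, hc, h⟩ := hinterior
        refine ⟨c, hc, ?_⟩
        rcases h with h | ⟨rfl, -⟩
        exacts [h.1, hza']
      · obtain ⟨c, hc, h⟩ := hinterior
        refine ⟨c, hc, ?_⟩
        rcases h with h | ⟨-, rfl⟩
        exacts [h.2, hzb']
  intro n hn
  obtain ⟨Z, hZI, hZ0, hxZ, hcard, hZa, hZb⟩ := hzeros n hn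
  rw [← hcard]
  exact vanishesTimes_of_finset hx.injective _ Z hZI hZa hZb (fun i hi => hxZ i (by omega)) hZ0
    fun i j hj hj0 => hmult n hn i j (by omega)
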